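/- arXiv:1108.0889 — 4 statements merged into one kernel-verified Lean document; each statement's English description precedes it below -/
import Mathlib

section
/- The graviton propagator of general higher-derivative 3D gravity: let σ, α, β, κ, Λ be reals with κ ≠ 0, Λ ≠ 0, and let k ∈ ℝ³ satisfy k² ≠ 0, σ + βκ²k²/4 ≠ 0, and −σ + 2ακ²k² + (3/4)βκ²k² ≠ 0. Define 𝒪 = [σk² + (βκ²k⁴)/4]P^{(2)} + (k²/2Λ)P^{(1)} + (k²/4Λ)P^{(0-w)} − (√2 k²/4Λ)P^{(0-sw)} − (√2 k²/4Λ)P^{(0-ws)} + [k²/2Λ − σk² + 2ακ²k⁴ + (3/4)βκ²k⁴]P^{(0-s)} and 𝒪⁻¹ = (2Λ/k²)P^{(1)} + [k²(σ + βκ²k²/4)]⁻¹ P^{(2)} + [−σk² + 2ακ²k⁴ + (3/4)βκ²k⁴]⁻¹ P^{(0-s)} + √2[−σk² + 2ακ²k⁴ + (3/4)βκ²k⁴]⁻¹ [P^{(0-sw)} + P^{(0-ws)}] + (−4Λσ + 2 + 8Λακ²k² + 3Λβκ²k²)[−σk² + 2ακ²k⁴ + (3/4)βκ²k⁴]⁻¹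 P^{(0-w)}. Then 𝒪·𝒪⁻¹ = P^{(2)} + P^{(1)} + P^{(0-s)} + P^{(0-w)}, the identity on symmetric rank-2 tensors. -/
open BigOperators Topology Filter

noncomputable section

/-- The 3D Minkowski metric η = diag(1, -1, -1). -/
def eta : Fin 3 → Fin 3 → ℝ :=
  fun μ ν => if μ = ν then (if μ = 0 then 1 else -1) else 0

/-- Lowered index: k_μ = η_{μν} k^ν. -/
def lowerIdx (k : Fin 3 → ℝ) (μ : Fin 3) : ℝ := ∑ ν, eta μ ν * k ν

/-- Minkowski square k² = η_{μν} k^μ k^ν. -/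
def ksq (k : Fin 3 → ℝ) : ℝ := ∑ μ, ∑ ν, eta μ ν * k μ * k ν

/-- Transverse projector θ_{μν} = η_{μν} - k_μ k_ν / k². -/
def θt (k : Fin 3 → ℝ) (μ ν : Fin 3) : ℝ :=
  eta μ ν - lowerIdx k μ * lowerIdx k ν / ksq k

/-- Longitudinal projector ω_{μν} = k_μ k_ν / k². -/
def ωt (k : Fin 3 → ℝ) (μ ν : Fin 3) : ℝ :=
  lowerIdx k μ * lowerIdx k ν / ksq k

/-- Rank-4 tensors (operators on symmetric rank-2 tensors), all indices down. -/
abbrev Tensor4 := Fin 3 → Fin 3 → Fin 3 → Fin 3 → ℝ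

/-- Barnes–Rivers spin-2 projector. -/
def P2 (k : Fin 3 → ℝ) : Tensor4 := fun μ ν κ lam =>
  (1/2) * (θt k μ κ * θt k ν lam + θt k μ lam * θt k ν κ - θt k μ ν * θt k κ lam)

/-- Barnes–Rivers spin-1 projector. -/
def P1 (k : Fin 3 → ℝ) : Tensor4 := fun μ ν κ lam =>
  (1/2) * (θt k μ κ * ωt k ν lam + θt k μ lam * ωt k ν κ +
           θt k ν lam * ωt k μ κ + θt k ν κ * ωt k μ lam)

/-- Barnes–Rivers spin-0 (s) projector. -/
def P0s (k : Fin 3 → ℝ) : Tensor4 := fun μ ν κ lam =>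
  (1/2) * (θt k μ ν * θt k κ lam)

/-- Barnes–Rivers spin-0 (w) projector. -/
def P0w (k : Fin 3 → ℝ) : Tensor4 := fun μ ν κ lam =>
  ωt k μ ν * ωt k κ lam

/-- Barnes–Rivers transfer operator P^{(0-sw)}. -/
def P0sw (k : Fin 3 → ℝ) : Tensor4 := fun μ ν κ lam =>
  (1 / Real.sqrt 2) * (θt k μ ν * ωt k κ lam)

/-- Barnes–Rivers transfer operator P^{(0-ws)}. -/
def P0ws (k : Fin 3 → ℝ) : Tensor4 := fun μ ν κ lam =>
  (1 / Real.sqrt 2) * (ωt k μ ν * θt k κ lam)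

/-- Contraction product (A·B)_{μν,κλ} = A_{μν}{}^{ρσ} B_{ρσ,κλ}, indices raised with η. -/
def bprod (A B : Tensor4) : Tensor4 := fun μ ν κ lam =>
  ∑ ρ, ∑ σ, ∑ ρ', ∑ σ', A μ ν ρ σ * eta ρ ρ' * eta σ σ' * B ρ' σ' κ lam

/-- Saturation T^{μν} P_{μν,κλ} T^{κλ} of a rank-4 operator with a current. -/
def satur (P : Tensor4) (T : Fin 3 → Fin 3 → ℝ) : ℝ :=
  ∑ μ, ∑ ν, ∑ κ, ∑ lam, T μ ν * P μ ν κ lam * T κ lam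

/-- Trace T = η_{μν} T^{μν}. -/
def trT (T : Fin 3 → Fin 3 → ℝ) : ℝ := ∑ μ, ∑ ν, eta μ ν * T μ ν

/-- Square T_{μν}T^{μν} = η_{μα} η_{νβ} T^{αβ} T^{μν}. -/
def Tsq (T : Fin 3 → Fin 3 → ℝ) : ℝ :=
  ∑ μ, ∑ ν, ∑ α, ∑ β, eta μ α * eta ν β * T α β * T μ ν

/-- Contraction `A_{μρ} η^{ρσ} B_{σν}` of two rank-2 tensors. -/
def contract (A B : Fin 3 → Fin 3 → ℝ) : Fin 3 → Fin 3 → ℝ :=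
  fun μ ν => ∑ ρ, ∑ σ, A μ ρ * eta ρ σ * B σ ν

/-- Full contraction `A_{μν} B^{μν}` of two rank-2 tensors. -/
def pairing (A B : Fin 3 → Fin 3 → ℝ) : ℝ :=
  ∑ ρ, ∑ σ, ∑ ρ', ∑ σ', A ρ σ * eta ρ ρ' * eta σ σ' * B ρ' σ'

/-- The rank-4 tensor `A_{μκ} B_{νλ}`. -/
def straight (A B : Fin 3 → Fin 3 → ℝ) : Tensor4 := fun μ ν κ lam => A μ κ * B ν lam

/-- The rank-4 tensor `A_{μλ} B_{νκ}`. -/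
def crossed (A B : Fin 3 → Fin 3 → ℝ) : Tensor4 := fun μ ν κ lam => A μ lam * B ν κ

/-- The rank-4 tensor `A_{μν} B_{κλ}`. -/
def outer (A B : Fin 3 → Fin 3 → ℝ) : Tensor4 := fun μ ν κ lam => A μ ν * B κ lam

section Bilinearity

variable (A B C : Tensor4) (c : ℝ)

lemma bprod_add_left : bprod (A + B) C = bprod A C + bprod B C := by
  funext μ ν κ lam
  simp only [bprod, Pi.add_apply, add_mul, Finset.sum_add_distrib]

lemma bprod_sub_left : bprod (A - B) C = bprod A C - bprod B C := by
  funext μ ν κ lam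
  simp only [bprod, Pi.sub_apply, sub_mul, Finset.sum_sub_distrib]

lemma bprod_smul_left : bprod (c • A) B = c • bprod A B := by
  funext μ ν κ lam
  simp only [bprod, Pi.smul_apply, smul_eq_mul, mul_assoc, Finset.mul_sum]

lemma bprod_add_right : bprod A (B + C) = bprod A B + bprod A C := by
  funext μ ν κ lam
  simp only [bprod, Pi.add_apply, mul_add, Finset.sum_add_distrib]

lemma bprod_sub_right : bprod A (B - C) = bprod A B - bprod A C := by
  funext μ ν κ lam
  simp only [bprod, Pi.sub_apply, mul_sub, Finset.sum_sub_distrib]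

lemma bprod_smul_right : bprod A (c • B) = c • bprod A B := by
  funext μ ν κ lam
  simp only [bprod, Pi.smul_apply, smul_eq_mul, mul_left_comm _ c, Finset.mul_sum]

end Bilinearity

section ElementaryProducts

variable (A B C D : Fin 3 → Fin 3 → ℝ)

lemma bprod_straight_straight :
    bprod (straight A B) (straight C D) = straight (contract A C) (contract B D) := by
  funext μ ν κ lam
  simp [bprod, straight, contract, eta, Fin.sum_univ_three]
  ring

lemma bprod_straight_crossed :
    bprod (straight A B) (crossed C D) = crossed (contract A C) (contract B D) := by
  funext μ ν κ lam
  simp [bprod, straight, crossed, contract, eta, Fin.sum_univ_three]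
  ring

lemma bprod_crossed_straight :
    bprod (crossed A B) (straight C D) = crossed (contract A D) (contract B C) := by
  funext μ ν κ lam
  simp [bprod, straight, crossed, contract, eta, Fin.sum_univ_three]
  ring

lemma bprod_crossed_crossed :
    bprod (crossed A B) (crossed C D) = straight (contract A D) (contract B C) := by
  funext μ ν κ lam
  simp [bprod, straight, crossed, contract, eta, Fin.sum_univ_three]
  ring

lemma bprod_straight_outer :
    bprod (straight A B) (outer C D) = outer (contract (contract A C) (flip B)) D := by
  funext μ ν κ lam
  simp [bprod, straight, outer, contract, flip, eta, Fin.sum_univ_three]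
  ring

lemma bprod_crossed_outer :
    bprod (crossed A B) (outer C D) = outer (contract (contract A (flip C)) (flip B)) D := by
  funext μ ν κ lam
  simp [bprod, crossed, outer, contract, flip, eta, Fin.sum_univ_three]
  ring

lemma bprod_outer_straight :
    bprod (outer A B) (straight C D) = outer A (contract (contract (flip C) B) D) := by
  funext μ ν κ lam
  simp [bprod, straight, outer, contract, flip, eta, Fin.sum_univ_three]
  ring

lemma bprod_outer_crossed :
    bprod (outer A B) (crossed C D) = outer A (contract (contract (flip D) (flip B)) C) := by
  funext μ ν κ lam
  simp [bprod, crossed, outer, contract, flip, eta, Fin.sum_univ_three]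
  ring

lemma bprod_outer_outer :
    bprod (outer A B) (outer C D) = pairing B C • outer A D := by
  funext μ ν κ lam
  simp [bprod, outer, pairing, eta, Fin.sum_univ_three]
  ring

end ElementaryProducts

lemma contract_zero_left (A : Fin 3 → Fin 3 → ℝ) : contract 0 A = 0 := by
  funext μ ν
  simp [contract]

lemma straight_zero_left (A : Fin 3 → Fin 3 → ℝ) : straight 0 A = 0 := by
  funext μ ν κ lam
  simp [straight]

lemma straight_zero_right (A : Fin 3 → Fin 3 → ℝ) : straight A 0 = 0 := by
  funext μ ν κ lam
  simp [straight]

lemma crossed_zero_left (A : Fin 3 → Fin 3 → ℝ) : crossed 0 A = 0 := by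
  funext μ ν κ lam
  simp [crossed]

lemma crossed_zero_right (A : Fin 3 → Fin 3 → ℝ) : crossed A 0 = 0 := by
  funext μ ν κ lam
  simp [crossed]

lemma outer_zero_left (A : Fin 3 → Fin 3 → ℝ) : outer 0 A = 0 := by
  funext μ ν κ lam
  simp [outer]

lemma outer_zero_right (A : Fin 3 → Fin 3 → ℝ) : outer A 0 = 0 := by
  funext μ ν κ lam
  simp [outer]

section Projectors

variable (k : Fin 3 → ℝ)

lemma eta_comm (μ ν : Fin 3) : eta μ ν = eta ν μ := by
  fin_cases μ <;> fin_cases ν <;> simp [eta]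

lemma flip_θt : flip (θt k) = θt k := by
  funext μ ν
  simp only [flip, θt, eta_comm ν μ, mul_comm (lowerIdx k ν)]

lemma flip_ωt : flip (ωt k) = ωt k := by
  funext μ ν
  simp only [flip, ωt, mul_comm (lowerIdx k ν)]

lemma θt_eq : θt k = eta - ωt k := rfl

lemma contract_eta_left (A : Fin 3 → Fin 3 → ℝ) : contract eta A = A := by
  funext μ ν
  fin_cases μ <;> simp [contract, eta, Fin.sum_univ_three]

lemma contract_eta_right (A : Fin 3 → Fin 3 → ℝ) : contract A eta = A := by
  funext μ ν
  fin_cases ν <;> simp [contract, eta]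

lemma contract_sub_left (A B C : Fin 3 → Fin 3 → ℝ) :
    contract (A - B) C = contract A C - contract B C := by
  funext μ ν
  simp only [contract, Pi.sub_apply, sub_mul, Finset.sum_sub_distrib]

lemma contract_sub_right (A B C : Fin 3 → Fin 3 → ℝ) :
    contract A (B - C) = contract A B - contract A C := by
  funext μ ν
  simp only [contract, Pi.sub_apply, mul_sub, Finset.sum_sub_distrib]

lemma ksq_eq : ksq k = k 0 ^ 2 - k 1 ^ 2 - k 2 ^ 2 := by
  simp [ksq, eta, Fin.sum_univ_three]
  ring

lemma lowerIdx_sq_eq_ksq :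
    lowerIdx k 0 ^ 2 - lowerIdx k 1 ^ 2 - lowerIdx k 2 ^ 2 = ksq k := by
  simp [ksq_eq, lowerIdx, eta]

variable {k} (hk : ksq k ≠ 0)
include hk

lemma contract_ωt_ωt : contract (ωt k) (ωt k) = ωt k := by
  funext μ ν
  simp [contract, ωt, eta, Fin.sum_univ_three]
  field_simp
  linear_combination lowerIdx k μ * lowerIdx k ν * lowerIdx_sq_eq_ksq k

lemma contract_θt_ωt : contract (θt k) (ωt k) = 0 := by
  rw [θt_eq, contract_sub_left, contract_eta_left, contract_ωt_ωt hk, sub_self]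

lemma contract_ωt_θt : contract (ωt k) (θt k) = 0 := by
  rw [θt_eq, contract_sub_right, contract_eta_right, contract_ωt_ωt hk, sub_self]

lemma contract_θt_θt : contract (θt k) (θt k) = θt k := by
  conv_lhs => arg 2; rw [θt_eq]
  rw [contract_sub_right, contract_eta_right, contract_θt_ωt hk, sub_zero]

lemma pairing_ωt_ωt : pairing (ωt k) (ωt k) = 1 := by
  simp [pairing, ωt, eta, Fin.sum_univ_three]
  field_simp
  linear_combination (ksq k + lowerIdx k 0 ^ 2 - lowerIdx k 1 ^ 2 - lowerIdx k 2 ^ 2) *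
    lowerIdx_sq_eq_ksq k

lemma pairing_θt_ωt : pairing (θt k) (ωt k) = 0 := by
  simp [pairing, θt, ωt, eta, Fin.sum_univ_three]
  field_simp
  linear_combination (-lowerIdx k 0 ^ 2 + lowerIdx k 1 ^ 2 + lowerIdx k 2 ^ 2) *
    lowerIdx_sq_eq_ksq k

lemma pairing_ωt_θt : pairing (ωt k) (θt k) = 0 := by
  simp [pairing, θt, ωt, eta, Fin.sum_univ_three]
  field_simp
  linear_combination (-lowerIdx k 0 ^ 2 + lowerIdx k 1 ^ 2 + lowerIdx k 2 ^ 2) *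
    lowerIdx_sq_eq_ksq k

lemma pairing_θt_θt : pairing (θt k) (θt k) = 2 := by
  simp [pairing, θt, eta, Fin.sum_univ_three]
  field_simp
  linear_combination (-ksq k + lowerIdx k 0 ^ 2 - lowerIdx k 1 ^ 2 - lowerIdx k 2 ^ 2) *
    lowerIdx_sq_eq_ksq k

end Projectors

section BarnesRivers

variable (k : Fin 3 → ℝ)

lemma P2_eq : P2 k = (1 / 2 : ℝ) •
    (straight (θt k) (θt k) + crossed (θt k) (θt k) - outer (θt k) (θt k)) := rfl

lemma P1_eq : P1 k = (1 / 2 : ℝ) • (straight (θt k) (ωt k) + crossed (θt k) (ωt k) +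
    straight (ωt k) (θt k) + crossed (ωt k) (θt k)) := by
  funext μ ν κ lam
  simp only [P1, straight, crossed, Pi.smul_apply, Pi.add_apply, smul_eq_mul]
  ring

lemma P0s_eq : P0s k = (1 / 2 : ℝ) • outer (θt k) (θt k) := rfl

lemma P0w_eq : P0w k = outer (ωt k) (ωt k) := rfl

lemma P0sw_eq : P0sw k = (1 / √2) • outer (θt k) (ωt k) := rfl

lemma P0ws_eq : P0ws k = (1 / √2) • outer (ωt k) (θt k) := rfl

end BarnesRivers

/-- The graviton propagator of general higher-derivative 3D gravity inverts the wave
operator on the space of symmetric rank-2 tensors. -/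
theorem higher_derivative_3D_propagator (σ α β κ Λ : ℝ) (hκ : κ ≠ 0) (hΛ : Λ ≠ 0)
    (k : Fin 3 → ℝ) (hk : ksq k ≠ 0)
    (h2 : σ + β * κ^2 * ksq k / 4 ≠ 0)
    (h0 : -σ + 2 * α * κ^2 * ksq k + (3/4) * β * κ^2 * ksq k ≠ 0)
    (O Oinv : Tensor4)
    (hO : O = (σ * ksq k + β * κ^2 * (ksq k)^2 / 4) • P2 k +
      (ksq k / (2 * Λ)) • P1 k + (ksq k / (4 * Λ)) • P0w k -
      (Real.sqrt 2 * ksq k / (4 * Λ)) • P0sw k -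
      (Real.sqrt 2 * ksq k / (4 * Λ)) • P0ws k +
      (ksq k / (2 * Λ) - σ * ksq k + 2 * α * κ^2 * (ksq k)^2 +
        (3/4) * β * κ^2 * (ksq k)^2) • P0s k)
    (hOinv : Oinv = (2 * Λ / ksq k) • P1 k +
      (ksq k * (σ + β * κ^2 * ksq k / 4))⁻¹ • P2 k +
      (-σ * ksq k + 2 * α * κ^2 * (ksq k)^2 + (3/4) * β * κ^2 * (ksq k)^2)⁻¹ • P0s k +
      (Real.sqrt 2 *
        (-σ * ksq k + 2 * α * κ^2 * (ksq k)^2 + (3/4) * β * κ^2 * (ksq k)^2)⁻¹) •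
        (P0sw k + P0ws k) +
      ((-4 * Λ * σ + 2 + 8 * Λ * α * κ^2 * ksq k + 3 * Λ * β * κ^2 * ksq k) *
        (-σ * ksq k + 2 * α * κ^2 * (ksq k)^2 + (3/4) * β * κ^2 * (ksq k)^2)⁻¹) • P0w k) :
    bprod O Oinv = P2 k + P1 k + P0s k + P0w k := by
  subst hO hOinv
  generalize hE : σ + β * κ^2 * ksq k / 4 = E at h2 ⊢
  generalize hF : -σ + 2 * α * κ^2 * ksq k + (3/4) * β * κ^2 * ksq k = F at h0
  have hA : σ * ksq k + β * κ^2 * (ksq k)^2 / 4 = ksq k * E := by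
    rw [← hE]
    ring
  have hD : -σ * ksq k + 2 * α * κ^2 * (ksq k)^2 + (3/4) * β * κ^2 * (ksq k)^2 = ksq k * F := by
    rw [← hF]
    ring
  have hS : ksq k / (2 * Λ) - σ * ksq k + 2 * α * κ^2 * (ksq k)^2 +
      (3/4) * β * κ^2 * (ksq k)^2 = ksq k / (2 * Λ) + ksq k * F := by
    rw [← hF]
    ring
  have hW : -4 * Λ * σ + 2 + 8 * Λ * α * κ^2 * ksq k + 3 * Λ * β * κ^2 * ksq k =
      4 * Λ * F + 2 := by
    rw [← hF]
    ring
  rw [hA, hD, hS, hW]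
  simp only [P2_eq, P1_eq, P0s_eq, P0w_eq, P0sw_eq, P0ws_eq,
    bprod_add_left, bprod_sub_left, bprod_smul_left,
    bprod_add_right, bprod_sub_right, bprod_smul_right,
    bprod_straight_straight, bprod_straight_crossed, bprod_crossed_straight,
    bprod_crossed_crossed, bprod_straight_outer, bprod_crossed_outer,
    bprod_outer_straight, bprod_outer_crossed, bprod_outer_outer, flip_θt, flip_ωt,
    contract_ωt_ωt hk, contract_θt_ωt hk, contract_ωt_θt hk, contract_θt_θt hk,
    pairing_ωt_ωt hk, pairing_θt_ωt hk, pairing_ωt_θt hk, pairing_θt_θt hk,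
    contract_zero_left, straight_zero_left, straight_zero_right, crossed_zero_left,
    crossed_zero_right, outer_zero_left, outer_zero_right,
    smul_zero, zero_smul, add_zero, zero_add, sub_zero]
  match_scalars <;> field_simp <;> ring
end
end

section
/- Positivity of the spin-2 saturation at a massive pole: let η = diag(1,−1,−1), let k ∈ ℝ³ with k² := η_{μν}k^μk^ν > 0, and let T^{μν} be a real symmetric 3×3 tensor with k_μT^{μν} = 0. Then T_{μν}T^{μν} − ½T² ≥ 0, with equality if and only if T^{μν} is a real scalar multiple of θ^{μν} = η^{μν} − k^μk^ν/k². -/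
open BigOperators Topology Filter

noncomputable section

/-- For `S = !![a, b; b, d]` and `G = 1 - w wᵀ` with `w = (u, v)`, the quantity
`(tr GS)² - 4 det (GS)` times `G₀₀²`, written as a sum of squares. -/
lemma spatial_form_eq_sum_sq (u v a b d : ℝ) :
    (1 - u ^ 2) ^ 2 * (((1 - u ^ 2) * a - 2 * u * v * b + (1 - v ^ 2) * d) ^ 2
        - 4 * (1 - u ^ 2 - v ^ 2) * (a * d - b ^ 2)) =
      ((1 - u ^ 2) ^ 2 * a - 2 * (1 - u ^ 2) * u * v * b + (u * v) ^ 2 * d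
        - (1 - u ^ 2 - v ^ 2) * d) ^ 2
      + 4 * (1 - u ^ 2 - v ^ 2) * ((1 - u ^ 2) * b - u * v * d) ^ 2 := by
  ring

/-- A timelike vector is `e • (1, u, v)` with `e ≠ 0` and `u² + v² < 1`. -/
lemma exists_velocity_of_ksq_pos (k : Fin 3 → ℝ) (hk : 0 < ksq k) :
    ∃ u v : ℝ, k 0 ≠ 0 ∧ k 1 = u * k 0 ∧ k 2 = v * k 0 ∧ 0 < 1 - u ^ 2 - v ^ 2 ∧
      ksq k = k 0 ^ 2 * (1 - u ^ 2 - v ^ 2) := by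
  have hsq : ksq k = k 0 ^ 2 - k 1 ^ 2 - k 2 ^ 2 := by
    simp [ksq, eta, Fin.sum_univ_three]
    ring
  have h0 : k 0 ≠ 0 := by
    intro h
    rw [hsq, h] at hk
    nlinarith [sq_nonneg (k 1), sq_nonneg (k 2)]
  have hfac : ksq k = k 0 ^ 2 * (1 - (k 1 / k 0) ^ 2 - (k 2 / k 0) ^ 2) := by
    rw [hsq]
    field_simp
  refine ⟨k 1 / k 0, k 2 / k 0, h0, by field_simp, by field_simp, ?_, hfac⟩
  exact pos_of_mul_pos_right (hfac ▸ hk) (sq_nonneg _)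

/-- Positivity of the spin-2 saturation at a massive pole: for timelike k and a
conserved symmetric current, T_{μν}T^{μν} - ½T² ≥ 0, with equality iff T is a
scalar multiple of θ^{μν} = η^{μν} - k^μ k^ν / k². -/
theorem spin2_saturation_positive (k : Fin 3 → ℝ) (hk : 0 < ksq k)
    (T : Fin 3 → Fin 3 → ℝ) (hsymm : ∀ μ ν, T μ ν = T ν μ)
    (hcons : ∀ ν, ∑ μ, lowerIdx k μ * T μ ν = 0) :
    0 ≤ Tsq T - (1/2) * (trT T)^2 ∧
    (Tsq T - (1/2) * (trT T)^2 = 0 ↔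
      ∃ c : ℝ, ∀ μ ν, T μ ν = c * (eta μ ν - k μ * k ν / ksq k)) := by
  obtain ⟨u, v, h0, h1, h2, hs, hksq⟩ := exists_velocity_of_ksq_pos k hk
  have hα : 0 < 1 - u ^ 2 := by nlinarith [sq_nonneg v]
  have hrow : ∀ ν, T 0 ν = u * T 1 ν + v * T 2 ν := by
    intro ν
    have h := hcons ν
    simp only [lowerIdx, eta, Fin.sum_univ_three, h1, h2] at h
    simp at h
    apply mul_left_cancel₀ h0
    linear_combination h
  have h10 : T 1 0 = u * T 1 1 + v * T 1 2 := by rw [hsymm 1 0, hrow, hsymm 2 1]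
  have h20 : T 2 0 = u * T 1 2 + v * T 2 2 := by rw [hsymm 2 0, hrow]
  have h21 : T 2 1 = T 1 2 := hsymm 2 1
  have h01 : T 0 1 = u * T 1 1 + v * T 1 2 := by rw [hrow, h21]
  have h02 : T 0 2 = u * T 1 2 + v * T 2 2 := hrow 2
  have h00 : T 0 0 = u * (u * T 1 1 + v * T 1 2) + v * (u * T 1 2 + v * T 2 2) := by
    rw [hrow, h10, h20]
  have hform : Tsq T - (1/2) * (trT T)^2 =
      (1/2) * (((1 - u ^ 2) * T 1 1 - 2 * u * v * T 1 2 + (1 - v ^ 2) * T 2 2) ^ 2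
        - 4 * (1 - u ^ 2 - v ^ 2) * (T 1 1 * T 2 2 - T 1 2 ^ 2)) := by
    simp [Tsq, trT, eta, Fin.sum_univ_three, h00, h01, h02, h10, h20, h21]
    ring
  have hsos := spatial_form_eq_sum_sq u v (T 1 1) (T 1 2) (T 2 2)
  rw [hform]
  set F := ((1 - u ^ 2) * T 1 1 - 2 * u * v * T 1 2 + (1 - v ^ 2) * T 2 2) ^ 2
        - 4 * (1 - u ^ 2 - v ^ 2) * (T 1 1 * T 2 2 - T 1 2 ^ 2) with hF
  constructor
  · have : 0 ≤ F := by
      refine nonneg_of_mul_nonneg_right (a := (1 - u ^ 2) ^ 2) ?_ (by positivity)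
      rw [hsos]
      positivity
    linarith
  constructor
  · intro hzero
    have hF0 : F = 0 := by linarith
    rw [hF0, mul_zero, eq_comm, add_eq_zero_iff_of_nonneg (by positivity) (by positivity)] at hsos
    obtain ⟨hdiag, hoff⟩ := hsos
    have hb : (1 - u ^ 2) * T 1 2 = u * v * T 2 2 := by
      have := pow_eq_zero_iff (two_ne_zero) |>.1 ((mul_eq_zero_iff_left (by positivity)).1 hoff)
      linarith
    have ha : (1 - u ^ 2) * T 1 1 = (1 - v ^ 2) * T 2 2 := by
      have := pow_eq_zero_iff (two_ne_zero) |>.1 hdiag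
      apply mul_left_cancel₀ hα.ne'
      linear_combination this + 2 * u * v * hb
    have hb' : T 1 2 = u * v * T 2 2 / (1 - u ^ 2) := by
      rw [eq_div_iff hα.ne']
      linarith
    have ha' : T 1 1 = (1 - v ^ 2) * T 2 2 / (1 - u ^ 2) := by
      rw [eq_div_iff hα.ne']
      linarith
    have hα' := hα.ne'
    have hs' := hs.ne'
    refine ⟨-(T 2 2 * (1 - u ^ 2 - v ^ 2) / (1 - u ^ 2)), fun μ ν => ?_⟩
    rw [hksq]
    fin_cases μ <;> fin_cases ν <;>
      simp [eta, h00, h01, h02, h10, h20, h21, h1, h2, ha', hb'] <;> field_simp <;> ring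
  · rintro ⟨c, hc⟩
    have h11 := hc 1 1
    have h12 := hc 1 2
    have h22 := hc 2 2
    have hs' := hs.ne'
    simp [eta, hksq, h1, h2] at h11 h12 h22
    rw [hF, h11, h12, h22]
    field_simp
    ring
end
end

section
/- Vanishing of the saturation combination at the massless pole: let η = diag(1,−1,−1), let k ∈ ℝ³ be a nonzero null vector (k ≠ 0, η_{μν}k^μk^ν = 0), and let T^{μν} be a real symmetric 3×3 tensor with k_μT^{μν} = 0. Then T_{μν}T^{μν} − T² = 0. -/
open BigOperators Topology Filter

noncomputable section

/-- At the massless pole: for nonzero null k and a conserved symmetric current,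
T_{μν}T^{μν} - T² = 0. -/
theorem massless_pole_saturation_vanishes (k : Fin 3 → ℝ) (hk : k ≠ 0)
    (hnull : ksq k = 0)
    (T : Fin 3 → Fin 3 → ℝ) (hsymm : ∀ μ ν, T μ ν = T ν μ)
    (hcons : ∀ ν, ∑ μ, lowerIdx k μ * T μ ν = 0) :
    Tsq T - (trT T)^2 = 0 := by
  have h0 := hcons 0
  have h1 := hcons 1
  have h2 := hcons 2
  simp only [lowerIdx, ksq, eta, Fin.sum_univ_three] at hnull h0 h1 h2
  simp [hsymm 1 0, hsymm 2 0, hsymm 2 1] at hnull h0 h1 h2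
  have ha : k 0 ≠ 0 := by
    intro ha
    apply hk
    have hb : k 1 = 0 := by nlinarith [sq_nonneg (k 1), sq_nonneg (k 2)]
    have hc : k 2 = 0 := by nlinarith [sq_nonneg (k 1), sq_nonneg (k 2)]
    ext i
    fin_cases i <;> assumption
  have key : k 0 ^ 2 * (Tsq T - (trT T) ^ 2) = 0 := by
    simp only [Tsq, trT, eta, Fin.sum_univ_three]
    simp [hsymm 1 0, hsymm 2 0, hsymm 2 1, -mul_eq_zero]
    linear_combination (2 * T 1 2 ^ 2 - 2 * T 1 1 * T 2 2) * hnull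
      - 2 * (k 0 * T 0 1 + k 1 * T 1 1 + k 2 * T 1 2) * h1
      - 2 * (k 0 * T 0 2 + k 1 * T 1 2 + k 2 * T 2 2) * h2
      + 2 * (T 1 1 + T 2 2) * (k 0 * h0 + k 1 * h1 + k 2 * h2)
  exact (mul_eq_zero.mp key).resolve_left (pow_ne_zero 2 ha)
end
end

section
/- Current decomposition identities (Eqs. B.5–B.6): let k = (k⁰, 𝐤) ∈ ℝ³ with 𝐤 ∈ ℝ² nonzero, k̃ = (k⁰, −𝐤), ε = (0, ε̂) with ε̂ ∈ ℝ² a unit vector orthogonal to 𝐤; write s := k² = (k⁰)² − |𝐤|² and q := (k⁰)² + |𝐤|². Suppose T^{μν} = A k^μk^ν + B k̃^μk̃^ν + C ε^με^ν + D k^{(μ}k̃^{ν)} + E k^{(μ}ε^{ν)} + F k̃^{(μ}ε^{ν)} with real coefficients satisfying the conservation constraints A s + (D/2)q = 0, B q + (D/2)s = 0, and E s + F q = 0. Then T_{μν}T^{μν} − ½T² = [s(A−B)/√2 − C/√2]² + (s/2)(E² − F²) and T_{μν}T^{μν} − T² = s[½(E² − F²) − 2C(A−B)]. -/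
open BigOperators Topology Filter

noncomputable section

/-- Minkowski inner product of two vectors. -/
def minkowskiInner (x y : Fin 3 → ℝ) : ℝ := x 0 * y 0 - x 1 * y 1 - x 2 * y 2

/-- The symmetric tensor with coefficients `A, …, F` in the products of `x`, `y`, `z`. -/
def symTensor (x y z : Fin 3 → ℝ) (A B C D E F : ℝ) (μ ν : Fin 3) : ℝ :=
  A * x μ * x ν + B * y μ * y ν + C * z μ * z ν +
    D * ((x μ * y ν + y μ * x ν) / 2) +
    E * ((x μ * z ν + z μ * x ν) / 2) +
    F * ((y μ * z ν + z μ * y ν) / 2)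

lemma trT_eq (T : Fin 3 → Fin 3 → ℝ) : trT T = T 0 0 - T 1 1 - T 2 2 := by
  simp [trT, eta, Fin.sum_univ_three]
  ring

lemma Tsq_eq (T : Fin 3 → Fin 3 → ℝ) :
    Tsq T = T 0 0 ^ 2 + T 1 1 ^ 2 + T 2 2 ^ 2 - T 0 1 ^ 2 - T 1 0 ^ 2 -
      T 0 2 ^ 2 - T 2 0 ^ 2 + T 1 2 ^ 2 + T 2 1 ^ 2 := by
  simp [Tsq, eta, Fin.sum_univ_three]
  ring

/-- Trace of a symmetric tensor when `z` is a unit spacelike vector orthogonal to `x`, `y`. -/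
lemma trT_symTensor {x y z : Fin 3 → ℝ} (A B C D E F : ℝ) (hzz : minkowskiInner z z = -1)
    (hxz : minkowskiInner x z = 0) (hyz : minkowskiInner y z = 0) :
    trT (symTensor x y z A B C D E F) =
      A * minkowskiInner x x + B * minkowskiInner y y - C + D * minkowskiInner x y := by
  rw [trT_eq]
  simp only [symTensor, minkowskiInner] at *
  linear_combination C * hzz + E * hxz + F * hyz

/-- Square of a symmetric tensor when `z` is a unit spacelike vector orthogonal to `x`, `y`. -/
lemma Tsq_symTensor {x y z : Fin 3 → ℝ} (A B C D E F : ℝ) (hzz : minkowskiInner z z = -1)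
    (hxz : minkowskiInner x z = 0) (hyz : minkowskiInner y z = 0) :
    Tsq (symTensor x y z A B C D E F) =
      A ^ 2 * minkowskiInner x x ^ 2 + B ^ 2 * minkowskiInner y y ^ 2 + C ^ 2 +
      D ^ 2 / 2 * (minkowskiInner x x * minkowskiInner y y + minkowskiInner x y ^ 2) +
      2 * A * B * minkowskiInner x y ^ 2 +
      2 * A * D * minkowskiInner x x * minkowskiInner x y +
      2 * B * D * minkowskiInner y y * minkowskiInner x y -
      E ^ 2 / 2 * minkowskiInner x x - F ^ 2 / 2 * minkowskiInner y y -
      E * F * minkowskiInner x y := by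
  have general : Tsq (symTensor x y z A B C D E F) =
      A ^ 2 * minkowskiInner x x ^ 2 + B ^ 2 * minkowskiInner y y ^ 2 +
      C ^ 2 * minkowskiInner z z ^ 2 +
      D ^ 2 / 2 * (minkowskiInner x x * minkowskiInner y y + minkowskiInner x y ^ 2) +
      E ^ 2 / 2 * (minkowskiInner x x * minkowskiInner z z + minkowskiInner x z ^ 2) +
      F ^ 2 / 2 * (minkowskiInner y y * minkowskiInner z z + minkowskiInner y z ^ 2) +
      2 * A * B * minkowskiInner x y ^ 2 + 2 * A * C * minkowskiInner x z ^ 2 +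
      2 * B * C * minkowskiInner y z ^ 2 +
      2 * A * D * minkowskiInner x x * minkowskiInner x y +
      2 * A * E * minkowskiInner x x * minkowskiInner x z +
      2 * A * F * minkowskiInner x y * minkowskiInner x z +
      2 * B * D * minkowskiInner y y * minkowskiInner x y +
      2 * B * E * minkowskiInner x y * minkowskiInner y z +
      2 * B * F * minkowskiInner y y * minkowskiInner y z +
      2 * C * D * minkowskiInner x z * minkowskiInner y z +
      2 * C * E * minkowskiInner x z * minkowskiInner z z +
      2 * C * F * minkowskiInner y z * minkowskiInner z z +
      D * E * (minkowskiInner x x * minkowskiInner y z +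
        minkowskiInner x z * minkowskiInner x y) +
      D * F * (minkowskiInner x y * minkowskiInner y z +
        minkowskiInner x z * minkowskiInner y y) +
      E * F * (minkowskiInner x y * minkowskiInner z z +
        minkowskiInner x z * minkowskiInner y z) := by
    rw [Tsq_eq]
    simp only [symTensor, minkowskiInner]
    ring
  rw [general, hzz, hxz, hyz]
  ring

/-- Current decomposition identities (Eqs. B.5–B.6) for a conserved symmetric
current expanded in the basis k, k̃, ε. -/
theorem current_decomposition_identities (k0 : ℝ) (kv eh : Fin 2 → ℝ)
    (hkv : kv ≠ 0)
    (heh : eh 0 ^ 2 + eh 1 ^ 2 = 1)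
    (horth : eh 0 * kv 0 + eh 1 * kv 1 = 0)
    (kk kt ep : Fin 3 → ℝ)
    (hkk : kk = ![k0, kv 0, kv 1]) (hkt : kt = ![k0, -kv 0, -kv 1])
    (hep : ep = ![0, eh 0, eh 1])
    (s q : ℝ) (hs : s = k0 ^ 2 - (kv 0 ^ 2 + kv 1 ^ 2))
    (hq : q = k0 ^ 2 + (kv 0 ^ 2 + kv 1 ^ 2))
    (A B C D E F : ℝ)
    (T : Fin 3 → Fin 3 → ℝ)
    (hT : ∀ μ ν, T μ ν = A * kk μ * kk ν + B * kt μ * kt ν + C * ep μ * ep ν +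
      D * ((kk μ * kt ν + kt μ * kk ν) / 2) +
      E * ((kk μ * ep ν + ep μ * kk ν) / 2) +
      F * ((kt μ * ep ν + ep μ * kt ν) / 2))
    (hc1 : A * s + (D / 2) * q = 0)
    (hc2 : B * q + (D / 2) * s = 0)
    (hc3 : E * s + F * q = 0) :
    Tsq T - (1/2) * (trT T)^2 =
      (s * (A - B) / Real.sqrt 2 - C / Real.sqrt 2) ^ 2 + (s / 2) * (E^2 - F^2) ∧
    Tsq T - (trT T)^2 = s * ((1/2) * (E^2 - F^2) - 2 * C * (A - B)) := by
  have hzz : minkowskiInner ep ep = -1 := by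
    simp [minkowskiInner, hep]
    linear_combination -heh
  have hxz : minkowskiInner kk ep = 0 := by
    simp [minkowskiInner, hkk, hep]
    linear_combination -horth
  have hyz : minkowskiInner kt ep = 0 := by
    simp [minkowskiInner, hkt, hep]
    linear_combination horth
  have hxx : minkowskiInner kk kk = s := by
    simp [minkowskiInner, hkk, hs]
    ring
  have hyy : minkowskiInner kt kt = s := by
    simp [minkowskiInner, hkt, hs]
    ring
  have hxy : minkowskiInner kk kt = q := by
    simp [minkowskiInner, hkk, hkt, hq]
    ring
  have hq0 : q ≠ 0 := by
    intro h
    refine hkv (funext fun i => ?_)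
    fin_cases i <;> simp <;> nlinarith [sq_nonneg k0, sq_nonneg (kv 0), sq_nonneg (kv 1)]
  have hAB : A * B = D ^ 2 / 4 := by
    by_cases hs0 : s = 0
    · have hD : D = 0 := by simpa [hs0, hq0] using hc1
      have hB : B = 0 := by simpa [hs0, hq0] using hc2
      simp [hD, hB]
    · refine mul_left_cancel₀ (mul_ne_zero hs0 hq0) ?_
      linear_combination B * q * hc1 - D / 2 * q * hc2
  obtain rfl : T = symTensor kk kt ep A B C D E F := funext₂ hT
  have htr : trT (symTensor kk kt ep A B C D E F) = -(s * (A - B) + C) := by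
    rw [trT_symTensor A B C D E F hzz hxz hyz, hxx, hyy, hxy]
    linear_combination 2 * hc1
  have hsq : Tsq (symTensor kk kt ep A B C D E F) =
      C ^ 2 + s ^ 2 * (A - B) ^ 2 + s / 2 * (E ^ 2 - F ^ 2) := by
    rw [Tsq_symTensor A B C D E F hzz hxz hyz, hxx, hyy, hxy]
    linear_combination 2 * (q ^ 2 + s ^ 2) * hAB + 2 * q * D * hc1 + 2 * s * D * hc2 - E * hc3
  have hsqrt : (s * (A - B) / √2 - C / √2) ^ 2 = (s * (A - B) - C) ^ 2 / 2 := by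
    rw [← sub_div, div_pow, Real.sq_sqrt zero_le_two]
  rw [htr, hsq, hsqrt]
  constructor <;> ring
end
end
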